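/- For every β ∈ (1,2), for μ_β-a.e. x ∈ ℝ, liminf_{r→0⁺} log μ_β(B̄(x,r)) / log r ≥ (log 2 / log β) · μ_β([0, β − 1]). (In particular, dim(μ_β) ≥ (log 2 / log β) · μ_β([0, β − 1]).) -/

import Mathlib

open MeasureTheory Filter Topology

/-- `m` is the infinite product on `{0,1}^ℕ` of the uniform measure on two points:
every cylinder of length `n` has mass `2⁻ⁿ`. -/
def IsCoinMeasure (m : Measure (ℕ → Fin 2)) : Prop :=
  IsProbabilityMeasure m ∧
  ∀ (n : ℕ) (w : Fin n → Fin 2),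
    m {x | ∀ j : Fin n, x j.1 = w j} = (2 : ENNReal)⁻¹ ^ n

/-- The coding map `π_β(ε) = (1 - 1/β) ∑_{n≥0} ε_n β^{-n}` of the Bernoulli convolution. -/
noncomputable def piBeta (β : ℝ) (x : ℕ → Fin 2) : ℝ :=
  (1 - 1/β) * ∑' n : ℕ, ((x n : ℕ) : ℝ) / β ^ n

namespace CoinSpace

open ProbabilityTheory

/-- Sequences with prescribed initial digits. -/
def cylinder (n : ℕ) (w : Fin n → Fin 2) : Set (ℕ → Fin 2) := {x | ∀ j : Fin n, x j.1 = w j}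

lemma measurableSet_cylinder (n : ℕ) (w : Fin n → Fin 2) : MeasurableSet (cylinder n w) := by
  have : cylinder n w = ⋂ j : Fin n, (fun x : ℕ → Fin 2 => x j.1) ⁻¹' {w j} := by
    ext x; simp [cylinder]
  rw [this]
  exact MeasurableSet.iInter fun j => (measurable_pi_apply _) (measurableSet_singleton _)

lemma isPiSystem_cylinder :
    IsPiSystem {s : Set (ℕ → Fin 2) | ∃ n w, s = cylinder n w} := by
  rintro _ ⟨n, w, rfl⟩ _ ⟨k, v, rfl⟩ ⟨x, hx, hx'⟩
  refine ⟨max n k, fun j => x j.1, ?_⟩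
  ext y
  constructor
  · rintro ⟨h1, h2⟩ j
    rcases lt_max_iff.1 j.2 with h | h
    · exact (h1 ⟨j.1, h⟩).trans (hx ⟨j.1, h⟩).symm
    · exact (h2 ⟨j.1, h⟩).trans (hx' ⟨j.1, h⟩).symm
  · intro h
    exact ⟨fun j => (h ⟨j.1, lt_max_of_lt_left j.2⟩).trans (hx j),
      fun j => (h ⟨j.1, lt_max_of_lt_right j.2⟩).trans (hx' j)⟩

lemma generateFrom_cylinder :
    (inferInstance : MeasurableSpace (ℕ → Fin 2)) =
      MeasurableSpace.generateFrom {s | ∃ n w, s = cylinder n w} := by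
  apply le_antisymm
  · refine iSup_le fun i => ?_
    rw [← measurable_iff_comap_le]
    refine @measurable_to_countable' _ _ _ _ (MeasurableSpace.generateFrom _) _ fun a => ?_
    have : (fun x : ℕ → Fin 2 => x i) ⁻¹' {a} =
        ⋃ w ∈ {w : Fin (i + 1) → Fin 2 | w (Fin.last i) = a}, cylinder (i + 1) w := by
      ext x
      simp only [Set.mem_preimage, Set.mem_singleton_iff, Set.mem_ofPred_eq, Set.mem_iUnion,
        cylinder, exists_prop]
      constructor
      · intro h
        exact ⟨fun j => x j.1, h, fun j => rfl⟩
      · rintro ⟨w, h, h'⟩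
        rw [← h, ← h' (Fin.last i), Fin.val_last]
    rw [this]
    exact MeasurableSet.biUnion (Set.to_countable _) fun w _ =>
      MeasurableSpace.measurableSet_generateFrom ⟨_, w, rfl⟩
  · refine MeasurableSpace.generateFrom_le ?_
    rintro _ ⟨n, w, rfl⟩
    exact measurableSet_cylinder n w

lemma coin_ext {m m' : Measure (ℕ → Fin 2)} (hm : IsCoinMeasure m) (hk : IsCoinMeasure m') :
    m = m' := by
  have := hm.1
  have := hk.1
  refine ext_of_generate_finite _ generateFrom_cylinder isPiSystem_cylinder ?_ (by simp)
  rintro _ ⟨n, w, rfl⟩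
  exact (hm.2 n w).trans (hk.2 n w).symm

/-- Prepend a digit to a sequence. -/
def cons (a : Fin 2) (x : ℕ → Fin 2) : ℕ → Fin 2
  | 0 => a
  | n + 1 => x n

/-- Drop the first `k` digits of a sequence. -/
def shift (k : ℕ) (x : ℕ → Fin 2) : ℕ → Fin 2 := fun n => x (n + k)

/-- Exchange the two digits. -/
def flip (x : ℕ → Fin 2) : ℕ → Fin 2 := fun n => 1 - x n

lemma measurable_cons (a : Fin 2) : Measurable (cons a) := by
  refine measurable_pi_lambda _ fun n => ?_
  cases n with
  | zero => exact measurable_const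
  | succ n => exact measurable_pi_apply n

lemma measurable_shift (k : ℕ) : Measurable (shift k) :=
  measurable_pi_lambda _ fun n => measurable_pi_apply (n + k)

lemma measurable_flip : Measurable flip :=
  measurable_pi_lambda _ fun n => (measurable_of_countable (1 - ·)).comp (measurable_pi_apply n)

lemma map_flip {m : Measure (ℕ → Fin 2)} (hm : IsCoinMeasure m) : m.map flip = m := by
  have := hm.1
  refine coin_ext ⟨Measure.isProbabilityMeasure_map measurable_flip.aemeasurable, fun n w => ?_⟩ hm
  have h := measurableSet_cylinder n w
  change (m.map flip) (cylinder n w) = _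
  rw [Measure.map_apply measurable_flip h, ← hm.2 n (fun j => 1 - w j)]
  congr 1
  ext x
  refine forall_congr' fun j => ?_
  change 1 - x j.1 = w j ↔ x j.1 = 1 - w j
  generalize x j.1 = a
  generalize w j = b
  revert a b
  decide

lemma coin_eq_add {m : Measure (ℕ → Fin 2)} (hm : IsCoinMeasure m) :
    m = (2 : ENNReal)⁻¹ • m.map (cons 0) + (2 : ENNReal)⁻¹ • m.map (cons 1) := by
  have := hm.1
  have h0 := Measure.isProbabilityMeasure_map (μ := m) (measurable_cons 0).aemeasurable
  have h1 := Measure.isProbabilityMeasure_map (μ := m) (measurable_cons 1).aemeasurable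
  refine coin_ext hm ⟨⟨?_⟩, fun n w => ?_⟩
  · simp [ENNReal.inv_two_add_inv_two]
  have h := measurableSet_cylinder n w
  change (_ + _ : Measure (ℕ → Fin 2)) (cylinder n w) = _
  rw [Measure.add_apply, Measure.smul_apply, Measure.smul_apply,
    Measure.map_apply (measurable_cons _) h, Measure.map_apply (measurable_cons _) h]
  cases n with
  | zero =>
    have : cylinder 0 w = Set.univ := by ext x; simp [cylinder]
    simp [this, ENNReal.inv_two_add_inv_two]
  | succ n =>
    have key : ∀ a, m (cons a ⁻¹' cylinder (n + 1) w) = if a = w 0 then 2⁻¹ ^ n else 0 := by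
      intro a
      split_ifs with ha
      · rw [← hm.2 n (fun j => w j.succ)]
        congr 1
        ext x
        simp only [cylinder, Set.mem_preimage, Set.mem_ofPred_eq, Fin.forall_fin_succ]
        simp [cons, ha]
      · convert measure_empty (μ := m)
        ext x
        simp only [cylinder, Set.mem_preimage, Set.mem_ofPred_eq, Fin.forall_fin_succ]
        simp [cons, ha]
    rw [key, key]
    rcases Fin.exists_fin_two.1 ⟨w 0, rfl⟩ with h | h <;> simp [h, pow_succ, mul_comm]

lemma coin_apply {m : Measure (ℕ → Fin 2)} (hm : IsCoinMeasure m) {s : Set (ℕ → Fin 2)}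
    (hs : MeasurableSet s) :
    m s = 2⁻¹ * m (cons 0 ⁻¹' s) + 2⁻¹ * m (cons 1 ⁻¹' s) := by
  conv_lhs => rw [coin_eq_add hm]
  rw [Measure.add_apply, Measure.smul_apply, Measure.smul_apply,
    Measure.map_apply (measurable_cons _) hs, Measure.map_apply (measurable_cons _) hs]
  rfl

lemma map_shift {m : Measure (ℕ → Fin 2)} (hm : IsCoinMeasure m) (k : ℕ) :
    m.map (shift k) = m := by
  induction k with
  | zero => exact Measure.map_id
  | succ k ih =>
    ext s hs
    rw [Measure.map_apply (measurable_shift _) hs, coin_apply hm (measurable_shift _ hs)]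
    have : ∀ a, cons a ⁻¹' (shift (k + 1) ⁻¹' s) = shift k ⁻¹' s := fun a => rfl
    rw [this, this, ← Measure.map_apply (measurable_shift _) hs, ih, ← add_mul,
      ENNReal.inv_two_add_inv_two, one_mul]

lemma iIndepFun_eval {m : Measure (ℕ → Fin 2)} (hm : IsCoinMeasure m) :
    iIndepFun (fun (i : ℕ) (x : ℕ → Fin 2) => x i) m := by
  have hP : IsProbabilityMeasure ((2 : ENNReal)⁻¹ • (Measure.count : Measure (Fin 2))) :=
    ⟨by simp [Measure.count_apply_finite _ Set.finite_univ, ENNReal.inv_mul_cancel]⟩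
  have : m = Measure.infinitePi
      (fun _ : ℕ => (2 : ENNReal)⁻¹ • (Measure.count : Measure (Fin 2))) := by
    refine coin_ext hm ⟨inferInstance, fun n w => ?_⟩
    have h := Measure.infinitePi_pi
      (fun _ : ℕ => (2 : ENNReal)⁻¹ • (Measure.count : Measure (Fin 2)))
      (s := Finset.range n) (t := fun i => if h : i < n then {w ⟨i, h⟩} else Set.univ)
      (fun i _ => MeasurableSet.of_discrete)
    convert h using 1
    · congr 1
      ext x
      simp only [Set.mem_ofPred_eq, Set.mem_pi, Finset.coe_range, Set.mem_Iio]
      constructor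
      · intro hx i hi
        simpa [hi] using hx ⟨i, hi⟩
      · intro hx j
        simpa using hx j.1 j.2
    · rw [Finset.prod_congr rfl (g := fun _ => (2 : ENNReal)⁻¹), Finset.prod_const,
        Finset.card_range]
      intro i hi
      simp [Finset.mem_range.1 hi]
  rw [this]
  exact iIndepFun_infinitePi (X := fun _ a => a) fun _ => measurable_id

variable {β : ℝ}

lemma digit_le_one (a : Fin 2) : ((a : ℕ) : ℝ) ≤ 1 := by
  exact_mod_cast Nat.lt_succ_iff.1 a.2

lemma summable_digits (hβ : 1 < β) (x : ℕ → Fin 2) :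
    Summable fun n : ℕ => ((x n : ℕ) : ℝ) / β ^ n := by
  have hβ0 : 0 < β := by linarith
  refine Summable.of_nonneg_of_le (fun n => by positivity) (fun n => ?_)
    (summable_geometric_of_lt_one (inv_nonneg.2 hβ0.le) (inv_lt_one_of_one_lt₀ hβ))
  rw [inv_pow, ← one_div]
  have := digit_le_one (x n)
  gcongr

lemma piBeta_eq (hβ : 1 < β) (x : ℕ → Fin 2) :
    piBeta β x = (1 - 1 / β) * ((x 0 : ℕ) : ℝ) + piBeta β (shift 1 x) / β := by
  have hβ0 : β ≠ 0 := by linarith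
  unfold piBeta
  rw [(summable_digits hβ x).tsum_eq_zero_add]
  have : ∀ n, ((x (n + 1) : ℕ) : ℝ) / β ^ (n + 1) = ((shift 1 x n : ℕ) : ℝ) / β ^ n / β := by
    intro n
    rw [div_div, ← pow_succ]
    rfl
  simp only [this, tsum_div_const, pow_zero, div_one]
  ring

lemma piBeta_shift_eq (hβ : 1 < β) (k : ℕ) (x : ℕ → Fin 2) :
    piBeta β (shift k x) =
      (1 - 1 / β) * ((x k : ℕ) : ℝ) + piBeta β (shift (k + 1) x) / β := by
  rw [piBeta_eq hβ]
  have : shift 1 (shift k x) = shift (k + 1) x := by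
    funext n
    simp only [shift]
    congr 1
    ring
  rw [this]
  simp [shift]

lemma piBeta_cons (hβ : 1 < β) (a : Fin 2) (x : ℕ → Fin 2) :
    piBeta β (cons a x) = (1 - 1 / β) * ((a : ℕ) : ℝ) + piBeta β x / β :=
  piBeta_eq hβ _

lemma one_sub_inv_pos (hβ : 1 < β) : 0 < 1 - 1 / β := by
  rw [sub_pos, div_lt_one (by linarith)]
  exact hβ

lemma piBeta_nonneg (hβ : 1 < β) (x : ℕ → Fin 2) : 0 ≤ piBeta β x :=
  mul_nonneg (one_sub_inv_pos hβ).le (tsum_nonneg fun n => by positivity)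

lemma piBeta_flip (hβ : 1 < β) (x : ℕ → Fin 2) : piBeta β (flip x) = 1 - piBeta β x := by
  have hβ0 : 0 < β := by linarith
  have h1 : ∑' n : ℕ, (β⁻¹) ^ n = (1 - β⁻¹)⁻¹ :=
    tsum_geometric_of_lt_one (inv_nonneg.2 hβ0.le) (inv_lt_one_of_one_lt₀ hβ)
  have h2 : piBeta β (flip x) + piBeta β x = (1 - 1 / β) * ∑' n : ℕ, (β⁻¹) ^ n := by
    unfold piBeta
    rw [← mul_add, ← (summable_digits hβ _).tsum_add (summable_digits hβ x)]
    congr 2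
    funext n
    rw [← add_div, inv_pow, ← one_div]
    congr 1
    simp only [flip]
    generalize x n = a
    fin_cases a <;> norm_num
  rw [h1, one_div, mul_inv_cancel₀] at h2
  · linarith
  · have := one_sub_inv_pos hβ
    rw [one_div] at this
    exact this.ne'

lemma piBeta_le_one (hβ : 1 < β) (x : ℕ → Fin 2) : piBeta β x ≤ 1 := by
  have := piBeta_nonneg hβ (flip x)
  rw [piBeta_flip hβ] at this
  linarith

lemma continuous_piBeta (hβ : 1 < β) : Continuous (piBeta β) := by
  have hβ0 : 0 < β := by linarith
  refine continuous_const.mul (continuous_tsum (u := fun n => β⁻¹ ^ n) (fun n => ?_)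
    (summable_geometric_of_lt_one (inv_nonneg.2 hβ0.le) (inv_lt_one_of_one_lt₀ hβ)) ?_)
  · exact (continuous_of_discreteTopology.comp (continuous_apply n) :
      Continuous ((fun a : Fin 2 => ((a : ℕ) : ℝ)) ∘ fun x : ℕ → Fin 2 => x n)).div_const _
  · intro n x
    have := digit_le_one (x n)
    rw [Real.norm_of_nonneg (by positivity), inv_pow, ← one_div]
    gcongr

lemma measurable_piBeta (hβ : 1 < β) : Measurable (piBeta β) :=
  (continuous_piBeta hβ).measurable

lemma piBeta_sub_eq (hβ : 1 < β) {x y : ℕ → Fin 2} {k : ℕ} (h : ∀ j < k, x j = y j) :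
    piBeta β x - piBeta β y = (piBeta β (shift k x) - piBeta β (shift k y)) / β ^ k := by
  induction k with
  | zero => simp; rfl
  | succ k ih =>
    have hβ0 : β ≠ 0 := by linarith
    rw [ih fun j hj => h j (by omega), piBeta_shift_eq hβ k x, piBeta_shift_eq hβ k y,
      h k (by omega)]
    field_simp
    ring

lemma abs_piBeta_sub_le (hβ : 1 < β) {x y : ℕ → Fin 2} {k : ℕ} (h : ∀ j < k, x j = y j) :
    |piBeta β x - piBeta β y| ≤ 1 / β ^ k := by
  have hβ0 : 0 < β := by linarith
  rw [piBeta_sub_eq hβ h, abs_div, abs_of_pos (pow_pos hβ0 k)]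
  gcongr
  have h1 := piBeta_nonneg hβ (shift k x)
  have h2 := piBeta_nonneg hβ (shift k y)
  have h3 := piBeta_le_one hβ (shift k x)
  have h4 := piBeta_le_one hβ (shift k y)
  rw [abs_le]
  constructor <;> linarith

lemma coin_real_apply {m : Measure (ℕ → Fin 2)} (hm : IsCoinMeasure m) {s : Set (ℕ → Fin 2)}
    (hs : MeasurableSet s) :
    m.real s = 2⁻¹ * m.real (cons 0 ⁻¹' s) + 2⁻¹ * m.real (cons 1 ⁻¹' s) := by
  have := hm.1
  simp only [Measure.real]
  rw [coin_apply hm hs, ENNReal.toReal_add (by finiteness) (by finiteness)]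
  simp

/-- Bernoulli convolutions have no atoms. -/
lemma measureReal_fiber_eq_zero (hβ : 1 < β) {m : Measure (ℕ → Fin 2)} (hm : IsCoinMeasure m)
    (y : ℝ) : m.real (piBeta β ⁻¹' {y}) = 0 := by
  have := hm.1
  have hβ0 : 0 < β := by linarith
  set f : ℝ → ℝ := fun y => m.real (piBeta β ⁻¹' {y}) with hf
  have hrec : ∀ y, f y = 2⁻¹ * f (β * y) + 2⁻¹ * f (β * y - (β - 1)) := by
    intro y
    simp only [hf]
    rw [coin_real_apply hm (measurable_piBeta hβ (measurableSet_singleton y))]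
    congr 3
    · ext x
      simp only [Set.mem_preimage, Set.mem_singleton_iff, piBeta_cons hβ]
      norm_num
      rw [div_eq_iff hβ0.ne', mul_comm]
    · ext x
      simp only [Set.mem_preimage, Set.mem_singleton_iff, piBeta_cons hβ]
      norm_num
      field_simp
      constructor <;> intro h <;> linarith
  have h0 : ∀ y, y < 0 ∨ 1 < y → f y = 0 := by
    intro y hy
    have : piBeta β ⁻¹' {y} = ∅ := by
      ext x
      have h1 := piBeta_nonneg hβ x
      have h2 := piBeta_le_one hβ x
      simp only [Set.mem_preimage, Set.mem_singleton_iff, Set.mem_empty_iff_false, iff_false]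
      rintro rfl
      rcases hy with hy | hy <;> linarith
    simp [hf, this]
  have hbdd : BddAbove (Set.range f) := ⟨1, by rintro _ ⟨y, rfl⟩; exact measureReal_le_one⟩
  set M := ⨆ y, f y with hM
  have hle : ∀ y, f y ≤ M := fun y => le_ciSup hbdd y
  have hM0 : 0 ≤ M := le_trans measureReal_nonneg (hle 0)
  have hiter : ∀ (n : ℕ) y, f y ≤ (1 - 2⁻¹ ^ n) * M + 2⁻¹ ^ n * f (β ^ n * y) := by
    intro n y
    induction n with
    | zero => simp
    | succ n ih =>
      rw [hrec (β ^ n * y)] at ih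
      have h3 := hle (β * (β ^ n * y) - (β - 1))
      have h4 : (2⁻¹ : ℝ) ^ n * f (β * (β ^ n * y) - (β - 1)) ≤ 2⁻¹ ^ n * M := by gcongr
      rw [pow_succ, pow_succ, mul_comm (β ^ n) β, mul_assoc β (β ^ n) y]
      linarith
  obtain ⟨N, hN⟩ := pow_unbounded_of_one_lt (1 / (1 - 1 / β)) hβ
  rw [div_lt_iff₀ (one_sub_inv_pos hβ)] at hN
  have hN1 : 1 ≤ N := by
    by_contra hN0
    obtain rfl : N = 0 := by omega
    have : 0 < 1 / β := by positivity
    simp only [pow_zero, one_mul] at hN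
    linarith
  have h2N : (2⁻¹ : ℝ) ^ N ≤ 2⁻¹ := by
    simpa using pow_le_pow_of_le_one (by norm_num : (0 : ℝ) ≤ 2⁻¹) (by norm_num) hN1
  have hbound : ∀ y, f y ≤ (1 - 2⁻¹ ^ N) * M := by
    intro y
    rcases lt_or_ge y (1 - 1 / β) with hy | hy
    · have h5 : β * y < β - 1 := by
        have := mul_lt_mul_of_pos_left hy hβ0
        have h6 : β * (1 - 1 / β) = β - 1 := by field_simp
        linarith
      rw [hrec y, h0 (β * y - (β - 1)) (Or.inl (by linarith))]
      have := hle (β * y)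
      nlinarith
    · have h5 : 1 < β ^ N * y := lt_of_lt_of_le hN (by gcongr)
      have := hiter N y
      rwa [h0 _ (Or.inr h5), mul_zero, add_zero] at this
  have hfin : M ≤ (1 - 2⁻¹ ^ N) * M := ciSup_le hbound
  have hpos : (0 : ℝ) < 2⁻¹ ^ N := by positivity
  have : M ≤ 0 := by nlinarith
  exact le_antisymm ((hle y).trans this) measureReal_nonneg

/-- The measure of the overlap of the two pieces of the attractor. -/
lemma measureReal_overlap (hβ : 1 < β) (hβ2 : β < 2) {m : Measure (ℕ → Fin 2)}
    (hm : IsCoinMeasure m) :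
    m.real (piBeta β ⁻¹' Set.Icc (1 - 1 / β) (1 / β)) =
      1 - m.real (piBeta β ⁻¹' Set.Icc 0 (β - 1)) := by
  have := hm.1
  have hβ0 : 0 < β := by linarith
  have hmeas := measurable_piBeta hβ
  have hhalf : 1 / 2 < 1 / β := by gcongr
  have hlow : m.real (piBeta β ⁻¹' Set.Iio (1 - 1 / β)) =
      2⁻¹ * m.real (piBeta β ⁻¹' Set.Iio (β - 1)) := by
    have e0 : cons 0 ⁻¹' (piBeta β ⁻¹' Set.Iio (1 - 1 / β)) = piBeta β ⁻¹' Set.Iio (β - 1) := by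
      ext x
      simp only [Set.mem_preimage, Set.mem_Iio, piBeta_cons hβ]
      norm_num
      rw [div_lt_iff₀ hβ0, sub_mul, inv_mul_cancel₀ hβ0.ne', one_mul]
    have e1 : cons 1 ⁻¹' (piBeta β ⁻¹' Set.Iio (1 - 1 / β)) = ∅ := by
      ext x
      simp only [Set.mem_preimage, Set.mem_Iio, piBeta_cons hβ, Set.mem_empty_iff_false,
        iff_false, not_lt]
      have : 0 ≤ piBeta β x / β := div_nonneg (piBeta_nonneg hβ x) hβ0.le
      norm_num
      exact this
    rw [coin_real_apply hm (hmeas measurableSet_Iio), e0, e1]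
    simp
  have hhigh : m.real (piBeta β ⁻¹' Set.Ioi (1 / β)) =
      m.real (piBeta β ⁻¹' Set.Iio (1 - 1 / β)) := by
    conv_lhs => rw [← map_flip hm, map_measureReal_apply measurable_flip (hmeas measurableSet_Ioi)]
    congr 1
    ext x
    simp only [Set.mem_preimage, Set.mem_Ioi, Set.mem_Iio, piBeta_flip hβ]
    constructor <;> intro h <;> linarith
  have hatom : m.real (piBeta β ⁻¹' Set.Icc 0 (β - 1)) =
      m.real (piBeta β ⁻¹' Set.Iio (β - 1)) := by
    have : piBeta β ⁻¹' Set.Icc 0 (β - 1) =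
        piBeta β ⁻¹' Set.Iio (β - 1) ∪ piBeta β ⁻¹' {β - 1} := by
      ext x
      simp only [Set.mem_preimage, Set.mem_Icc, Set.mem_union, Set.mem_Iio,
        Set.mem_singleton_iff, ← le_iff_lt_or_eq]
      exact and_iff_right (piBeta_nonneg hβ x)
    rw [this, measureReal_union _ (hmeas (measurableSet_singleton _)),
      measureReal_fiber_eq_zero hβ hm, add_zero]
    rw [Set.disjoint_left]
    intro x hx hx'
    exact (ne_of_lt hx) hx'
  have hcompl : (piBeta β ⁻¹' Set.Icc (1 - 1 / β) (1 / β))ᶜ =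
      piBeta β ⁻¹' Set.Iio (1 - 1 / β) ∪ piBeta β ⁻¹' Set.Ioi (1 / β) := by
    ext x
    simp only [Set.mem_compl_iff, Set.mem_preimage, Set.mem_Icc, Set.mem_union, Set.mem_Iio,
      Set.mem_Ioi, not_and_or, not_le]
  have h1 := probReal_compl_eq_one_sub (μ := m)
    (hmeas (measurableSet_Icc (a := 1 - 1 / β) (b := 1 / β)))
  rw [hcompl, measureReal_union _ (hmeas measurableSet_Ioi), hhigh, hlow] at h1
  · linarith
  · rw [Set.disjoint_left]
    intro x hx hx'
    simp only [Set.mem_preimage, Set.mem_Iio, Set.mem_Ioi] at hx hx'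
    linarith

lemma sum_range_mul_eq (f : ℕ → ℝ) (J N : ℕ) :
    ∑ k ∈ Finset.range (N * J), f k =
      ∑ i ∈ Finset.range J, ∑ l ∈ Finset.range N, f (i + l * J) := by
  induction N with
  | zero => simp
  | succ N ih =>
    simp only [Finset.sum_range_succ, Finset.sum_add_distrib, add_mul, one_mul,
      Finset.sum_range_add, ih]
    congr 1
    exact Finset.sum_congr rfl fun i _ => by rw [add_comm]

open Classical in
/-- Upper bound in the law of large numbers for the visits of the shift orbit to a set which
depends on finitely many digits. -/
lemma ae_eventually_card_visits_le {m : Measure (ℕ → Fin 2)} (hm : IsCoinMeasure m)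
    {A : Set (ℕ → Fin 2)} (hA : MeasurableSet A) {J : ℕ} (hJ : 0 < J)
    (hdep : ∀ x y : ℕ → Fin 2, (∀ j < J, x j = y j) → x ∈ A → y ∈ A) {q : ℝ}
    (hq : m.real A < q) :
    ∀ᵐ x ∂m, ∀ᶠ n : ℕ in atTop,
      (((Finset.range n).filter fun k => shift k x ∈ A).card : ℝ) ≤ q * n := by
  have := hm.1
  set g : ℕ → (ℕ → Fin 2) → ℝ := fun k x => A.indicator 1 (shift k x) with hg
  have hgm : ∀ k, Measurable (g k) := fun k =>
    (measurable_one.indicator hA).comp (measurable_shift k)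
  have hg0 : ∀ k x, 0 ≤ g k x := fun k x => Set.indicator_nonneg (fun _ _ => zero_le_one) _
  have hident : ∀ k l, IdentDistrib (g k) (g l) m m := by
    intro k l
    refine ⟨(hgm k).aemeasurable, (hgm l).aemeasurable, ?_⟩
    have : ∀ k, m.map (g k) = m.map (A.indicator 1) := by
      intro k
      conv_rhs => rw [← map_shift hm k]
      rw [Measure.map_map (measurable_one.indicator hA) (measurable_shift k)]
      rfl
    rw [this, this]
  have hmean : ∀ k, ∫ x, g k x ∂m = m.real A := by
    intro k
    rw [(hident k 0).integral_eq]
    exact integral_indicator_one hA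
  have hindep : ∀ k l, k + J ≤ l → IndepFun (g k) (g l) m := by
    intro k l hkl
    have hfac : ∀ k, ∃ φ : ((Finset.Ico k (k + J) : Finset ℕ) → Fin 2) → ℝ,
        g k = φ ∘ fun x i => x i.1 := by
      intro k
      refine ⟨fun v => A.indicator 1 fun n => if h : n + k ∈ Finset.Ico k (k + J) then
        v ⟨n + k, h⟩ else 0, ?_⟩
      funext x
      have hxy : ∀ j < J, shift k x j =
          if n : j + k ∈ Finset.Ico k (k + J) then x (j + k) else 0 := by
        intro j hj
        have : j + k ∈ Finset.Ico k (k + J) := Finset.mem_Ico.2 ⟨by omega, by omega⟩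
        simp [this, shift]
      simp only [hg, Function.comp_apply]
      simp only [Set.indicator_apply]
      congr 1
      exact propext ⟨hdep _ _ hxy, hdep _ _ fun j hj => (hxy j hj).symm⟩
    obtain ⟨φ, hφ⟩ := hfac k
    obtain ⟨ψ, hψ⟩ := hfac l
    rw [hφ, hψ]
    refine ((iIndepFun_eval hm).indepFun_finset _ _ ?_ fun i => measurable_pi_apply i).comp
      (measurable_of_countable φ) (measurable_of_countable ψ)
    rw [Finset.disjoint_left]
    intro i hi hi'
    rw [Finset.mem_Ico] at hi hi'
    omega
  have hslln : ∀ i, ∀ᵐ x ∂m, Tendsto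
      (fun N : ℕ => (∑ l ∈ Finset.range N, g (i + l * J) x) / N) atTop (𝓝 (m.real A)) := by
    intro i
    have := strong_law_ae_real (fun l => g (i + l * J)) (μ := m) ?_ ?_ fun l => hident _ _
    · simpa only [hmean] using this
    · exact (integrable_const (1 : ℝ)).mono' (hgm _).aestronglyMeasurable
        (Eventually.of_forall fun x => by
          rw [Real.norm_of_nonneg (hg0 _ _)]
          exact Set.indicator_le_self' (fun _ _ => zero_le_one) _)
    · intro k l hkl
      rcases lt_or_gt_of_ne hkl with h | h
      · exact hindep _ _ (by nlinarith)
      · exact (hindep _ _ (by nlinarith)).symm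
  obtain ⟨q', hq1, hq2⟩ := exists_between hq
  have hq0 : 0 ≤ q' := measureReal_nonneg.trans hq1.le
  filter_upwards [ae_all_iff.2 hslln] with x hx
  have hev : ∀ᶠ N : ℕ in atTop, ∀ i ∈ Finset.range J,
      ∑ l ∈ Finset.range N, g (i + l * J) x ≤ q' * N := by
    rw [Filter.eventually_all_finset]
    intro i _
    filter_upwards [(hx i).eventually (gt_mem_nhds hq1), eventually_gt_atTop 0] with N hN hN0
    rw [div_lt_iff₀ (by exact_mod_cast hN0)] at hN
    exact hN.le
  have hdiv : Tendsto (fun n : ℕ => n / J + 1) atTop atTop :=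
    (tendsto_add_atTop_nat 1).comp (Nat.tendsto_div_const_atTop hJ.ne')
  filter_upwards [hdiv.eventually hev,
    tendsto_natCast_atTop_atTop.eventually_ge_atTop (q' * J / (q - q'))] with n hn hnq
  rw [div_le_iff₀ (sub_pos.2 hq2)] at hnq
  have hcard : (((Finset.range n).filter fun k => shift k x ∈ A).card : ℝ) =
      ∑ k ∈ Finset.range n, g k x := by
    rw [Finset.card_filter]
    push_cast
    refine Finset.sum_congr rfl fun k _ => ?_
    simp [hg, Set.indicator_apply]
  have hle : n ≤ (n / J + 1) * J := by
    have := Nat.div_add_mod n J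
    have := Nat.mod_lt n hJ
    nlinarith
  have hle' : (((n / J + 1 : ℕ)) : ℝ) * J ≤ n + J := by
    have : (n / J + 1) * J ≤ n + J := by
      have := Nat.div_mul_le_self n J
      nlinarith
    exact_mod_cast this
  calc (((Finset.range n).filter fun k => shift k x ∈ A).card : ℝ)
      = ∑ k ∈ Finset.range n, g k x := hcard
    _ ≤ ∑ k ∈ Finset.range ((n / J + 1) * J), g k x :=
      Finset.sum_le_sum_of_subset_of_nonneg (Finset.range_mono hle) fun k _ _ => hg0 k x
    _ = ∑ i ∈ Finset.range J, ∑ l ∈ Finset.range (n / J + 1), g (i + l * J) x :=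
      sum_range_mul_eq (fun k => g k x) _ _
    _ ≤ ∑ i ∈ Finset.range J, q' * ((n / J + 1 : ℕ) : ℝ) := Finset.sum_le_sum hn
    _ = q' * (((n / J + 1 : ℕ) : ℝ) * J) := by
      rw [Finset.sum_const, Finset.card_range, nsmul_eq_mul]
      ring
    _ ≤ q' * (n + J) := by gcongr
    _ ≤ q * n := by linarith

/-- The overlap region, enlarged by `c / β ^ J` on both sides. -/
def overlap (β c : ℝ) (J : ℕ) : Set ℝ := Set.Icc (1 - 1 / β - c / β ^ J) (1 / β + c / β ^ J)

lemma measurableSet_overlap (c : ℝ) (J : ℕ) : MeasurableSet (overlap β c J) :=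
  measurableSet_Icc

lemma exists_measureReal_overlap_lt (hβ : 1 < β) {m : Measure (ℕ → Fin 2)}
    (hm : IsCoinMeasure m) {c q : ℝ} (hc : 0 ≤ c)
    (hq : m.real (piBeta β ⁻¹' Set.Icc (1 - 1 / β) (1 / β)) < q) :
    ∃ J : ℕ, 0 < J ∧ m.real (piBeta β ⁻¹' overlap β c J) < q := by
  have := hm.1
  have hβ0 : 0 < β := by linarith
  have hlim : Tendsto (fun J : ℕ => c / β ^ J) atTop (𝓝 0) :=
    (tendsto_pow_atTop_atTop_of_one_lt hβ).const_div_atTop c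
  have hInter : ⋂ J, piBeta β ⁻¹' overlap β c J = piBeta β ⁻¹' Set.Icc (1 - 1 / β) (1 / β) := by
    rw [← Set.preimage_iInter]
    congr 1
    ext y
    simp only [Set.mem_iInter, overlap, Set.mem_Icc]
    constructor
    · intro h
      constructor
      · have h1 := hlim.const_sub (1 - 1 / β)
        rw [sub_zero] at h1
        exact le_of_tendsto' h1 fun J => (h J).1
      · have h1 := hlim.const_add (1 / β)
        rw [add_zero] at h1
        exact ge_of_tendsto' h1 fun J => (h J).2
    · rintro ⟨h1, h2⟩ J
      have : 0 ≤ c / β ^ J := by positivity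
      constructor <;> linarith
  have hanti : Antitone fun J => piBeta β ⁻¹' overlap β c J := by
    intro J K hJK
    refine Set.preimage_mono ?_
    have : c / β ^ K ≤ c / β ^ J := by gcongr; exact hβ.le
    exact Set.Icc_subset_Icc (by linarith) (by linarith)
  have ht := tendsto_measure_iInter_atTop (μ := m)
    (fun J => (measurable_piBeta hβ (measurableSet_overlap c J)).nullMeasurableSet) hanti
    ⟨0, measure_ne_top _ _⟩
  rw [hInter] at ht
  have ht' := (ENNReal.tendsto_toReal (measure_ne_top _ _)).comp ht
  obtain ⟨J, h1, h2⟩ := ((ht'.eventually (gt_mem_nhds hq)).and (eventually_gt_atTop 0)).exists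
  exact ⟨J, h2, h1⟩

open Classical in
lemma ae_eventually_card_overlap_le (hβ : 1 < β) {m : Measure (ℕ → Fin 2)}
    (hm : IsCoinMeasure m) {q : ℝ}
    (hq : m.real (piBeta β ⁻¹' Set.Icc (1 - 1 / β) (1 / β)) < q) :
    ∃ J : ℕ, ∀ᵐ x ∂m, ∀ᶠ n : ℕ in atTop,
      (((Finset.range n).filter fun k => piBeta β (shift k x) ∈ overlap β 2 J).card : ℝ) ≤
        q * n := by
  have := hm.1
  have hβ0 : 0 < β := by linarith
  obtain ⟨J, hJ, hlt⟩ := exists_measureReal_overlap_lt hβ hm (c := 4) (by norm_num) hq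
  refine ⟨J, ?_⟩
  set trunc : (ℕ → Fin 2) → ℕ → Fin 2 := fun x n => if n < J then x n else 0 with htr
  have htm : Measurable trunc := by
    refine measurable_pi_lambda _ fun n => ?_
    by_cases h : n < J
    · simpa [htr, h] using measurable_pi_apply n
    · simp [htr, h]
  have hclose : ∀ x, |piBeta β (trunc x) - piBeta β x| ≤ (β ^ J)⁻¹ := fun x => by
    rw [← one_div]
    exact abs_piBeta_sub_le hβ fun j hj => by simp [htr, hj]
  have hpos : 0 < (β ^ J)⁻¹ := by positivity
  have hup : ∀ x, piBeta β x ∈ overlap β 2 J → piBeta β (trunc x) ∈ overlap β 3 J := by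
    intro x hx
    have h := abs_le.1 (hclose x)
    simp only [overlap, Set.mem_Icc, div_eq_mul_inv] at hx ⊢
    constructor <;> linarith [hx.1, hx.2, h.1, h.2]
  have hdown : ∀ x, piBeta β (trunc x) ∈ overlap β 3 J → piBeta β x ∈ overlap β 4 J := by
    intro x hx
    have h := abs_le.1 (hclose x)
    simp only [overlap, Set.mem_Icc, div_eq_mul_inv] at hx ⊢
    constructor <;> linarith [hx.1, hx.2, h.1, h.2]
  have hlln := ae_eventually_card_visits_le hm
    (A := (fun x => piBeta β (trunc x)) ⁻¹' overlap β 3 J)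
    (((measurable_piBeta hβ).comp htm) measurableSet_Icc) hJ (q := q) ?_ ?_
  · filter_upwards [hlln] with x hx
    filter_upwards [hx] with n hn
    refine le_trans ?_ hn
    exact_mod_cast Finset.card_le_card
      (Finset.monotone_filter_right _ fun k _ hk => hup _ hk)
  · intro x y hxy hx
    have : trunc x = trunc y := by
      funext n
      simp only [htr]
      split_ifs with h
      · exact hxy n h
      · rfl
    simpa only [Set.mem_preimage, this] using hx
  · exact lt_of_le_of_lt (measureReal_mono hdown) hlt

open Classical in
/-- Kraft-type estimate: if the members of `A` only separate at times satisfying `P`, and each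
member has at most `b` such times before `n`, then `A` meets at most `2 ^ b` cylinders. -/
lemma measure_le_of_card_branch_le {m : Measure (ℕ → Fin 2)} (hm : IsCoinMeasure m)
    (P : ℕ → (ℕ → Fin 2) → Prop) (n : ℕ) (d : ℕ) : ∀ (s b : ℕ) (A : Set (ℕ → Fin 2)),
    s + d = n → (∀ x ∈ A, ∀ y ∈ A, ∀ j < s, x j = y j) →
    (∀ x ∈ A, ∀ y ∈ A, ∀ k < n, (∀ j < k, x j = y j) → x k ≠ y k → P k x) →
    (∀ x ∈ A, ((Finset.Ico s n).filter fun k => P k x).card ≤ b) →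
    m A ≤ 2 ^ b * 2⁻¹ ^ n := by
  induction d with
  | zero =>
    intro s b A hs hA _ _
    rcases A.eq_empty_or_nonempty with rfl | ⟨x, hx⟩
    · simp
    calc m A ≤ m {y | ∀ j : Fin n, y j.1 = x j.1} :=
          measure_mono fun y hy j => hA y hy x hx j.1 (by omega)
      _ = 1 * 2⁻¹ ^ n := by rw [hm.2 n fun j => x j.1, one_mul]
      _ ≤ _ := by gcongr; exact one_le_pow₀ (by norm_num)
  | succ d ih =>
    intro s b A hs hA hP hb
    have hsn : s < n := by omega
    have hsplit : ∀ x, ((Finset.Ico s n).filter fun k => P k x).card =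
        ((Finset.Ico (s + 1) n).filter fun k => P k x).card + if P s x then 1 else 0 := by
      intro x
      rw [← Finset.insert_Ico_add_one_left_eq_Ico hsn, Finset.filter_insert]
      split_ifs with h
      · rw [Finset.card_insert_of_notMem (by simp)]
      · rfl
    have hext : ∀ B ⊆ A, (∀ x ∈ B, ∀ y ∈ B, x s = y s) →
        ∀ x ∈ B, ∀ y ∈ B, ∀ j < s + 1, x j = y j := by
      intro B hBA hB x hx y hy j hj
      rcases Nat.lt_succ_iff_lt_or_eq.1 hj with h | rfl
      · exact hA x (hBA hx) y (hBA hy) j h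
      · exact hB x hx y hy
    by_cases hsame : ∀ x ∈ A, ∀ y ∈ A, x s = y s
    · refine ih (s + 1) b A (by omega) (hext A subset_rfl hsame) hP fun x hx => ?_
      have := hb x hx
      rw [hsplit] at this
      omega
    · push Not at hsame
      obtain ⟨u, hu, v, hv, huv⟩ := hsame
      have hPs : ∀ x ∈ A, P s x := by
        intro x hx
        by_cases hxu : x s = u s
        · exact hP x hx v hv s hsn (hA x hx v hv) (hxu ▸ huv)
        · exact hP x hx u hu s hsn (hA x hx u hu) hxu
      obtain ⟨b, rfl⟩ : ∃ c, b = c + 1 := by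
        have := hb u hu
        rw [hsplit, if_pos (hPs u hu)] at this
        exact ⟨b - 1, by omega⟩
      have hpart : ∀ a, m {x ∈ A | x s = a} ≤ 2 ^ b * 2⁻¹ ^ n := by
        intro a
        refine ih (s + 1) b _ (by omega)
          (hext _ (fun x hx => hx.1) fun x hx y hy => hx.2.trans hy.2.symm)
          (fun x hx y hy => hP x hx.1 y hy.1) fun x hx => ?_
        have := hb x hx.1
        rw [hsplit, if_pos (hPs x hx.1)] at this
        omega
      have hcover : A ⊆ {x ∈ A | x s = 0} ∪ {x ∈ A | x s = 1} := by
        intro x hx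
        rcases Fin.exists_fin_two.1 ⟨x s, rfl⟩ with h | h
        · exact Or.inl ⟨hx, h⟩
        · exact Or.inr ⟨hx, h⟩
      calc m A ≤ _ := measure_mono hcover
        _ ≤ _ := measure_union_le _ _
        _ ≤ 2 ^ b * 2⁻¹ ^ n + 2 ^ b * 2⁻¹ ^ n := add_le_add (hpart 0) (hpart 1)
        _ = _ := by ring

/-- Two close points with the same first `k` digits and different next digits have orbits
passing through the enlarged overlap. -/
lemma piBeta_shift_mem_overlap (hβ : 1 < β) {x y : ℕ → Fin 2} {k J n : ℕ}
    (h : ∀ j < k, x j = y j) (hk : x k ≠ y k) (hn : k + J ≤ n)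
    (hxy : |piBeta β x - piBeta β y| ≤ 2 / β ^ n) : piBeta β (shift k x) ∈ overlap β 2 J := by
  have hβ0 : 0 < β := by linarith
  have hdist : |piBeta β (shift k x) - piBeta β (shift k y)| ≤ 2 / β ^ J := by
    rw [piBeta_sub_eq hβ h, abs_div, abs_of_pos (pow_pos hβ0 k), div_le_iff₀ (by positivity)] at hxy
    refine hxy.trans ?_
    rw [div_mul_eq_mul_div, div_le_div_iff₀ (by positivity) (by positivity), mul_assoc, ← pow_add]
    gcongr
    exact hβ.le
  have h0 : ∀ z : ℕ → Fin 2, z k = 0 → piBeta β (shift k z) ≤ 1 / β := by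
    intro z hz
    rw [piBeta_shift_eq hβ, hz]
    have := piBeta_le_one hβ (shift (k + 1) z)
    have : piBeta β (shift (k + 1) z) / β ≤ 1 / β := by gcongr
    simpa using this
  have h1 : ∀ z : ℕ → Fin 2, z k = 1 → 1 - 1 / β ≤ piBeta β (shift k z) := by
    intro z hz
    rw [piBeta_shift_eq hβ, hz]
    have : 0 ≤ piBeta β (shift (k + 1) z) / β := div_nonneg (piBeta_nonneg hβ _) hβ0.le
    simpa using this
  have hpos : 0 < 2 / β ^ J := by positivity
  have hd := abs_le.1 hdist
  rcases Fin.exists_fin_two.1 ⟨x k, rfl⟩ with hx | hx <;>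
    rcases Fin.exists_fin_two.1 ⟨y k, rfl⟩ with hy | hy
  · exact absurd (hx.trans hy.symm) hk
  · exact ⟨by linarith [h1 y hy, hd.1], by linarith [h0 x hx]⟩
  · exact ⟨by linarith [h1 x hx], by linarith [h0 y hy, hd.2]⟩
  · exact absurd (hx.trans hy.symm) hk

open Classical in
/-- Sequences whose orbit visits the enlarged overlap with frequency at most `q` from time `N`. -/
def rarelyOverlapping (β q : ℝ) (J N : ℕ) : Set (ℕ → Fin 2) :=
  {x | ∀ n : ℕ, N ≤ n →
    (((Finset.range n).filter fun k => piBeta β (shift k x) ∈ overlap β 2 J).card : ℝ) ≤ q * n}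

lemma measurableSet_rarelyOverlapping (hβ : 1 < β) (q : ℝ) (J N : ℕ) :
    MeasurableSet (rarelyOverlapping β q J N) := by
  classical
  simp only [rarelyOverlapping, Set.ofPred_forall]
  refine MeasurableSet.iInter fun n => MeasurableSet.iInter fun _ => ?_
  refine measurableSet_le ?_ measurable_const
  simp only [Finset.card_filter]
  push_cast
  exact Finset.measurable_sum _ fun k _ => Measurable.ite
    (((measurable_piBeta hβ).comp (measurable_shift k)) (measurableSet_overlap 2 J))
    measurable_const measurable_const

lemma measureReal_rarelyOverlapping_inter_le (hβ : 1 < β) {m : Measure (ℕ → Fin 2)}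
    (hm : IsCoinMeasure m) {q : ℝ} {J N n : ℕ} (hn : N ≤ n) (y : ℝ) :
    m.real (rarelyOverlapping β q J N ∩ piBeta β ⁻¹' Metric.closedBall y (β ^ n)⁻¹) ≤
      2 ^ J * (2 : ℝ) ^ (-((1 - q) * n)) := by
  classical
  set A := rarelyOverlapping β q J N ∩ piBeta β ⁻¹' Metric.closedBall y (β ^ n)⁻¹ with hA
  rcases A.eq_empty_or_nonempty with h | ⟨z, hz⟩
  · rw [h, measureReal_empty]
    positivity
  have hqn : 0 ≤ q * n := (Nat.cast_nonneg _).trans (hz.1 n hn)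
  have hle : m A ≤ 2 ^ (J + ⌊q * n⌋₊) * 2⁻¹ ^ n := by
    refine measure_le_of_card_branch_le hm
      (fun k x => n < k + J ∨ piBeta β (shift k x) ∈ overlap β 2 J) n n 0 _ A (zero_add n)
      (fun _ _ _ _ j hj => absurd hj (Nat.not_lt_zero j)) ?_ ?_
    · intro u hu v hv k _ huv hne
      refine or_iff_not_imp_left.2 fun hkJ => piBeta_shift_mem_overlap hβ huv hne (not_lt.1 hkJ) ?_
      have h1 := hu.2
      have h2 := hv.2
      rw [Set.mem_preimage, Metric.mem_closedBall, Real.dist_eq, abs_le] at h1 h2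
      rw [div_eq_mul_inv, abs_le]
      constructor <;> linarith [h1.1, h1.2, h2.1, h2.2]
    · intro x hx
      calc _ ≤ (Finset.Ico (n - J) n ∪ (Finset.range n).filter fun k =>
              piBeta β (shift k x) ∈ overlap β 2 J).card := Finset.card_le_card fun k hk => by
            simp only [Finset.mem_filter, Finset.mem_Ico, Finset.mem_union,
              Finset.mem_range] at hk ⊢
            exact hk.2.imp (fun h => ⟨by omega, hk.1.2⟩) fun h => ⟨hk.1.2, h⟩
        _ ≤ _ := Finset.card_union_le _ _
        _ ≤ J + ⌊q * n⌋₊ := add_le_add (by rw [Nat.card_Ico]; omega) (Nat.le_floor (hx.1 n hn))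
  calc m.real A ≤ ((2 : ENNReal) ^ (J + ⌊q * n⌋₊) * 2⁻¹ ^ n).toReal :=
        ENNReal.toReal_mono (by finiteness) hle
    _ = (2 : ℝ) ^ J * ((2 : ℝ) ^ (⌊q * n⌋₊ : ℝ) * (2 : ℝ) ^ (-(n : ℝ))) := by
        rw [Real.rpow_neg (by norm_num), Real.rpow_natCast, Real.rpow_natCast]
        simp [pow_add, mul_assoc]
    _ ≤ (2 : ℝ) ^ J * ((2 : ℝ) ^ (q * n) * (2 : ℝ) ^ (-(n : ℝ))) := by
        gcongr
        · norm_num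
        · exact Nat.floor_le hqn
    _ = _ := by
        rw [← Real.rpow_add (by norm_num)]
        congr 2
        ring

lemma tendsto_inv_pow_nhdsGT (hβ : 1 < β) :
    Tendsto (fun n : ℕ => (β ^ n)⁻¹) atTop (𝓝[>] 0) :=
  tendsto_inv_atTop_nhdsGT_zero.comp (tendsto_pow_atTop_atTop_of_one_lt hβ)

lemma ae_eventually_measureReal_closedBall_le (hβ : 1 < β) (hβ2 : β < 2)
    {m : Measure (ℕ → Fin 2)} (hm : IsCoinMeasure m) {t : ℝ}
    (ht : t < (m.map (piBeta β)).real (Set.Icc 0 (β - 1))) :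
    ∀ᵐ y ∂(m.map (piBeta β)), ∃ C : ℝ, ∀ᶠ n : ℕ in atTop,
      (m.map (piBeta β)).real (Metric.closedBall y (β ^ n)⁻¹) ≤ C * (2 : ℝ) ^ (-(t * n)) := by
  have := hm.1
  have hmeas := measurable_piBeta hβ
  have hμ : IsProbabilityMeasure (m.map (piBeta β)) :=
    Measure.isProbabilityMeasure_map hmeas.aemeasurable
  rw [map_measureReal_apply hmeas measurableSet_Icc] at ht
  obtain ⟨J, hJ⟩ := ae_eventually_card_overlap_le hβ hm (q := 1 - t)
    (by rw [measureReal_overlap hβ hβ2 hm]; linarith)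
  set G := rarelyOverlapping β (1 - t) J with hG
  have hGm : ∀ N, MeasurableSet (G N) := measurableSet_rarelyOverlapping hβ _ J
  have hac : m ≪ Measure.sum fun N => m.restrict (G N) := by
    refine Measure.AbsolutelyContinuous.mk fun s hs h => ?_
    rw [Measure.sum_apply _ hs, ENNReal.tsum_eq_zero] at h
    have hall : ∀ᵐ x ∂m, ∀ N, ¬ x ∈ s ∩ G N := by
      refine ae_all_iff.2 fun N => ?_
      rw [← measure_eq_zero_iff_ae_notMem, ← Measure.restrict_apply hs]
      exact h N
    rw [measure_eq_zero_iff_ae_notMem]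
    filter_upwards [hall, hJ] with x hx hxJ hxs
    obtain ⟨N, hN⟩ := eventually_atTop.1 hxJ
    exact hx N ⟨hxs, hN⟩
  have hac' := hac.map hmeas
  rw [Measure.map_sum hmeas.aemeasurable] at hac'
  refine hac'.ae_le (Measure.ae_sum_iff.2 fun N => ?_)
  set ν := (m.restrict (G N)).map (piBeta β) with hν
  have hνfin : IsFiniteMeasure ν := Measure.isFiniteMeasure_map _ _
  have hνμ : ν ≪ m.map (piBeta β) := Measure.restrict_le_self.absolutelyContinuous.map hmeas
  have := Measure.haveLebesgueDecomposition_of_sigmaFinite ν (m.map (piBeta β))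
  filter_upwards [hνμ.ae_le (Besicovitch.ae_tendsto_rnDeriv ν (m.map (piBeta β))),
    Measure.rnDeriv_pos hνμ] with y hy hpos
  obtain ⟨c, hc0, hc⟩ := exists_between hpos
  have hctop : c ≠ ⊤ := (hc.trans_le le_top).ne
  have hcpos : 0 < c.toReal := ENNReal.toReal_pos hc0.ne' hctop
  refine ⟨2 ^ J / c.toReal, ?_⟩
  filter_upwards [(tendsto_inv_pow_nhdsGT hβ).eventually (hy.eventually (lt_mem_nhds hc)),
    eventually_ge_atTop N] with n hn hNn
  have h1 : c * (m.map (piBeta β)) (Metric.closedBall y (β ^ n)⁻¹) ≤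
      ν (Metric.closedBall y (β ^ n)⁻¹) := ENNReal.mul_le_of_le_div hn.le
  have h2 := ENNReal.toReal_mono (measure_ne_top _ _) h1
  rw [ENNReal.toReal_mul] at h2
  have h3 : ν.real (Metric.closedBall y (β ^ n)⁻¹) ≤ 2 ^ J * (2 : ℝ) ^ (-(t * n)) := by
    rw [hν, map_measureReal_apply hmeas Metric.isClosed_closedBall.measurableSet,
      measureReal_restrict_apply (hmeas Metric.isClosed_closedBall.measurableSet), Set.inter_comm]
    simpa using measureReal_rarelyOverlapping_inter_le hβ hm (q := 1 - t) (J := J) hNn y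
  rw [div_mul_eq_mul_div, le_div_iff₀ hcpos, mul_comm]
  exact h2.trans h3

lemma two_inv_pow_le_measureReal_closedBall (hβ : 1 < β) {m : Measure (ℕ → Fin 2)}
    (hm : IsCoinMeasure m) (x : ℕ → Fin 2) (n : ℕ) :
    (2⁻¹ : ℝ) ^ n ≤ (m.map (piBeta β)).real (Metric.closedBall (piBeta β x) (β ^ n)⁻¹) := by
  have := hm.1
  rw [map_measureReal_apply (measurable_piBeta hβ) Metric.isClosed_closedBall.measurableSet]
  calc (2⁻¹ : ℝ) ^ n = m.real {y | ∀ j : Fin n, y j.1 = x j.1} := by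
        simp [Measure.real, hm.2 n fun j => x j.1]
    _ ≤ _ := measureReal_mono fun y hy => by
        rw [Set.mem_preimage, Metric.mem_closedBall, Real.dist_eq, ← one_div]
        exact abs_piBeta_sub_le hβ fun j hj => hy ⟨j, hj⟩

/-- A bound on the measure of balls with radii in a geometric progression bounds the lower local
dimension from below. -/
lemma le_liminf_log_div_log (hβ : 1 < β) {μ : Measure ℝ} [IsFiniteMeasure μ] {y t C : ℝ}
    (hlow : ∀ n : ℕ, (2⁻¹ : ℝ) ^ n ≤ μ.real (Metric.closedBall y (β ^ n)⁻¹))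
    (hup : ∀ᶠ n : ℕ in atTop,
      μ.real (Metric.closedBall y (β ^ n)⁻¹) ≤ C * (2 : ℝ) ^ (-(t * n))) :
    Real.log 2 / Real.log β * t ≤
      liminf (fun r : ℝ => Real.log (μ.real (Metric.closedBall y r)) / Real.log r) (𝓝[>] 0) := by
  have hβ0 : 0 < β := by linarith
  have hlogβ : 0 < Real.log β := Real.log_pos hβ
  have hlog2 : 0 < Real.log 2 := Real.log_pos one_lt_two
  have hcob : IsCoboundedUnder (· ≥ ·) (𝓝[>] (0 : ℝ))
      (fun r : ℝ => Real.log (μ.real (Metric.closedBall y r)) / Real.log r) := by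
    refine IsCoboundedUnder.of_frequently_le (a := Real.log 2 / Real.log β)
      ((tendsto_inv_pow_nhdsGT hβ).frequently (Eventually.frequently ?_))
    filter_upwards [eventually_gt_atTop 0] with n hn
    have hn' : (0 : ℝ) < n := by exact_mod_cast hn
    have h1 := Real.log_le_log (by positivity) (hlow n)
    rw [Real.log_pow, Real.log_inv] at h1
    rw [Real.log_inv, Real.log_pow, div_le_iff_of_neg (by nlinarith)]
    have : Real.log 2 / Real.log β * -(n * Real.log β) = n * -Real.log 2 := by
      field_simp
    rwa [this]
  obtain ⟨n₀, hn₀⟩ := eventually_atTop.1 hup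
  have hC : 0 < C := by
    have h1 := (hlow n₀).trans (hn₀ n₀ le_rfl)
    have h2 : (0 : ℝ) < 2⁻¹ ^ n₀ := by positivity
    exact pos_of_mul_pos_left (h2.trans_le h1) (by positivity)
  set D := Real.log 2 / Real.log β * t with hD
  set K := Real.log C + |t| * Real.log 2 with hK
  have hsmall : ∀ᶠ r in 𝓝[>] (0 : ℝ), r < min 1 ((β ^ n₀)⁻¹) :=
    nhdsWithin_le_nhds (gt_mem_nhds (by positivity))
  have hmain : ∀ᶠ r in 𝓝[>] (0 : ℝ),
      D + K / Real.log r ≤ Real.log (μ.real (Metric.closedBall y r)) / Real.log r := by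
    filter_upwards [hsmall, self_mem_nhdsWithin] with r hr hr0
    rw [Set.mem_Ioi] at hr0
    obtain ⟨hr1, hrn⟩ := lt_min_iff.1 hr
    have hlogr : Real.log r < 0 := Real.log_neg hr0 hr1
    obtain ⟨n, hn1, hn2⟩ := exists_nat_pow_near_of_lt_one hr0 hr1.le (inv_pos.2 hβ0)
      (inv_lt_one_of_one_lt₀ hβ)
    rw [inv_pow] at hn1 hn2
    have hnn : n₀ ≤ n := by
      have h1 := hn1.trans hrn
      rw [inv_lt_inv₀ (by positivity) (by positivity)] at h1
      exact Nat.lt_succ_iff.1 ((pow_lt_pow_iff_right₀ hβ).1 h1)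
    have hpos : 0 < μ.real (Metric.closedBall y r) := by
      have h1 : (0 : ℝ) < 2⁻¹ ^ (n + 1) := by positivity
      exact h1.trans_le ((hlow (n + 1)).trans
        (measureReal_mono (Metric.closedBall_subset_closedBall hn1.le)))
    have hball : μ.real (Metric.closedBall y r) ≤ C * (2 : ℝ) ^ (-(t * n)) :=
      (measureReal_mono (Metric.closedBall_subset_closedBall hn2)).trans (hn₀ n hnn)
    have h1 := Real.log_le_log hpos hball
    rw [Real.log_mul hC.ne' (by positivity), Real.log_rpow two_pos] at h1
    have h2 := Real.log_lt_log (by positivity) hn1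
    have h3 := Real.log_le_log hr0 hn2
    rw [Real.log_inv, Real.log_pow] at h2 h3
    push_cast at h2
    have habs : |(Real.log r + n * Real.log β) / Real.log β| ≤ 1 := by
      rw [abs_div, abs_of_pos hlogβ, div_le_one hlogβ, abs_le]
      constructor <;> linarith
    have h4 : -(|t| * Real.log 2) ≤ D * Real.log r + t * n * Real.log 2 := by
      have h5 : D * Real.log r + t * n * Real.log 2 =
          t * Real.log 2 * ((Real.log r + n * Real.log β) / Real.log β) := by
        rw [hD]
        field_simp
      rw [h5]
      refine le_trans (neg_le_neg ?_) (neg_abs_le _)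
      rw [abs_mul, abs_mul, abs_of_pos hlog2]
      exact mul_le_of_le_one_right (by positivity) habs
    rw [le_div_iff_of_neg hlogr, add_mul, div_mul_cancel₀ _ hlogr.ne]
    linarith
  have hlim : Tendsto (fun r : ℝ => D + K / Real.log r) (𝓝[>] 0) (𝓝 D) := by
    simpa using (Real.tendsto_log_nhdsGT_zero.const_div_atBot K).const_add D
  refine le_of_forall_lt_imp_le_of_dense fun a ha => le_liminf_of_le hcob ?_
  filter_upwards [hmain, hlim.eventually (lt_mem_nhds ha)] with r h1 h2
  exact h2.le.trans h1

end CoinSpace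

theorem stmt15 (β : ℝ) (hβ1 : 1 < β) (hβ2 : β < 2)
    (m : Measure (ℕ → Fin 2)) (hm : IsCoinMeasure m) :
    ∀ᵐ x ∂(m.map (piBeta β)),
      (Real.log 2 / Real.log β) *
          ((m.map (piBeta β)) (Set.Icc (0 : ℝ) (β - 1))).toReal ≤
        liminf (fun r : ℝ =>
          Real.log (((m.map (piBeta β)) (Metric.closedBall x r)).toReal) / Real.log r)
          (𝓝[>] 0) := by
  have := hm.1
  have hmeas := CoinSpace.measurable_piBeta hβ1
  have hμ : IsProbabilityMeasure (m.map (piBeta β)) :=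
    Measure.isProbabilityMeasure_map hmeas.aemeasurable
  set p := ((m.map (piBeta β)) (Set.Icc (0 : ℝ) (β - 1))).toReal with hp
  have hrange : MeasurableSet (Set.range (piBeta β)) :=
    (isCompact_range (CoinSpace.continuous_piBeta hβ1)).isClosed.measurableSet
  have hall : ∀ᵐ y ∂(m.map (piBeta β)), ∀ j : ℕ, ∃ C : ℝ, ∀ᶠ n : ℕ in atTop,
      (m.map (piBeta β)).real (Metric.closedBall y (β ^ n)⁻¹) ≤
        C * (2 : ℝ) ^ (-((p - 1 / ((j : ℝ) + 1)) * n)) :=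
    ae_all_iff.2 fun j => CoinSpace.ae_eventually_measureReal_closedBall_le hβ1 hβ2 hm
      (sub_lt_self _ (by positivity))
  filter_upwards [hall, ae_map_mem_range (piBeta β) hrange m] with y hy hyr
  obtain ⟨x, rfl⟩ := hyr
  have hlim : Tendsto (fun j : ℕ => Real.log 2 / Real.log β * (p - 1 / ((j : ℝ) + 1))) atTop
      (𝓝 (Real.log 2 / Real.log β * p)) := by
    simpa using (tendsto_one_div_add_atTop_nhds_zero_nat.const_sub p).const_mul
      (Real.log 2 / Real.log β)
  refine le_of_tendsto' hlim fun j => ?_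
  obtain ⟨C, hC⟩ := hy j
  exact CoinSpace.le_liminf_log_div_log hβ1
    (CoinSpace.two_inv_pow_le_measureReal_closedBall hβ1 hm x) hC
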